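/- Let (Ω, F, P) be a probability space, let α ∈ (0,1), and let Θ ⊆ ℝ³ be a compact set. Let (y_t)_{t≥1}, (u_t)_{t≥1}, (v_t)_{t≥1} be real random variables, and for β = (β₀, β₁, β₂) ∈ ℝ³ define the residuals z_t(β) = y_t − β₀ − β₁·u_t − β₂·v_t; assume there is K ≥ 0 with E[z_t(β)²] ≤ K² for all t ≥ 1 and all β ∈ Θ. Fix a real k ≥ 2 and C ≥ 0. For each T ≥ 1 let M(T) > 0 and let N_{t,T}, N^c_{t,T}, N^d_{t,T} (t = 1, …, T) be real random variables satisfying E[|N_{t,T}|^k] ≤ C·M(T)^{−k/2}, E[|N^c_{t,T}|^k] ≤ C·M(T)^{−k/2}, and E[|N^d_{t,T}|^k] ≤ C·M(T)^{−k/2}. Define the infeasible objective QR_T(β) = (1/T)·Σ_{t=1}^T ρ_α(z_t(β)) and the feasible objective QR_{T,M}(β) = (1/T)·Σ_{t=1}^T ρ_α( z_t(β) + N_{t,T} − β₁·N^c_{t,T} − β₂·N^d_{t,T} ). If T^{2/(2k−1)}·M(T)^{−1/2} → 0 as T → ∞, then sup_{β ∈ Θ} |QR_{T,M}(β) − QR_T(β)|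 → 0 in probability as T → ∞. -/

import Mathlib

open MeasureTheory Filter

/-- The check (tick-loss) function `ρ_α(x) = (α − 1{x ≤ 0})·x`. -/
noncomputable def checkFun (α x : ℝ) : ℝ := (α - if x ≤ 0 then 1 else 0) * x

theorem abs_checkFun_sub_le {α : ℝ} (hα : α ∈ Set.Icc (0 : ℝ) 1) (a b : ℝ) :
    |checkFun α a - checkFun α b| ≤ |a - b| := by
  obtain ⟨h0, h1⟩ := hα
  unfold checkFun
  rcases abs_cases (a - b) with ⟨h, h'⟩ | ⟨h, h'⟩ <;> rw [h, abs_le] <;>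
    split_ifs <;> constructor <;> nlinarith

theorem le_add_rpow_mul_rpow {k s x : ℝ} (hk : 1 ≤ k) (hs : 0 < s) (hx : 0 ≤ x) :
    x ≤ s + s ^ (1 - k) * x ^ k := by
  rcases le_total x s with h | h
  · have : 0 ≤ s ^ (1 - k) * x ^ k := by positivity
    linarith
  · have hx0 : 0 < x := hs.trans_le h
    calc x = x ^ (1 - k) * x ^ k := by rw [← Real.rpow_add hx0]; simp
      _ ≤ s ^ (1 - k) * x ^ k :=
        mul_le_mul_of_nonneg_right (Real.rpow_le_rpow_of_nonpos hs h (by linarith)) (by positivity)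
      _ ≤ s + s ^ (1 - k) * x ^ k := by linarith

section Moment

variable {Ω : Type*} [MeasurableSpace Ω] {P : Measure Ω} {X : Ω → ℝ} {k C s : ℝ}

theorem integrable_abs_of_integrable_rpow [IsFiniteMeasure P] (hX : Measurable X) (hk : 1 ≤ k)
    (hint : Integrable (fun ω => |X ω| ^ k) P) : Integrable (fun ω => |X ω|) P := by
  refine ((integrable_const (1 : ℝ)).add hint).mono' hX.abs.aestronglyMeasurable (.of_forall ?_)
  intro ω
  simpa using le_add_rpow_mul_rpow hk one_pos (abs_nonneg (X ω))

theorem integral_abs_le_of_integral_rpow_le [IsProbabilityMeasure P] (hX : Measurable X)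
    (hk : 1 ≤ k) (hs : 0 < s) (hint : Integrable (fun ω => |X ω| ^ k) P)
    (hmom : ∫ ω, |X ω| ^ k ∂P ≤ C * s ^ k) : ∫ ω, |X ω| ∂P ≤ (1 + C) * s := by
  have hc : s ^ (1 - k) * s ^ k = s := by rw [← Real.rpow_add hs]; simp
  calc ∫ ω, |X ω| ∂P ≤ ∫ ω, (s + s ^ (1 - k) * |X ω| ^ k) ∂P :=
        integral_mono (integrable_abs_of_integrable_rpow hX hk hint)
          ((integrable_const s).add (hint.const_mul _))
          fun ω => le_add_rpow_mul_rpow hk hs (abs_nonneg (X ω))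
    _ = s + s ^ (1 - k) * ∫ ω, |X ω| ^ k ∂P := by
        rw [integral_add (integrable_const s) (hint.const_mul _), integral_const_mul]
        simp
    _ ≤ s + s ^ (1 - k) * (C * s ^ k) := by gcongr
    _ = (1 + C) * s := by linear_combination C * hc

end Moment

theorem tendsto_zero_of_tendsto_rpow_mul {p : ℝ} (hp : 0 ≤ p) {f : ℕ → ℝ} (hf : ∀ T, 0 ≤ f T)
    (h : Tendsto (fun T : ℕ => (T : ℝ) ^ p * f T) atTop (nhds 0)) :
    Tendsto f atTop (nhds 0) := by
  refine squeeze_zero' (.of_forall hf) ?_ h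
  filter_upwards [eventually_ge_atTop 1] with T hT
  exact le_mul_of_one_le_left (hf T) (Real.one_le_rpow (by exact_mod_cast hT) hp)

theorem abs_checkFun_mean_sub_le {α : ℝ} (hα : α ∈ Set.Icc (0 : ℝ) 1) {B b c : ℝ}
    (hb : |b| ≤ B) (hc : |c| ≤ B) (T : ℕ) (z n n₁ n₂ : ℕ → ℝ) :
    |(1 / (T : ℝ)) * ∑ t ∈ Finset.Icc 1 T, checkFun α (z t + n t - b * n₁ t - c * n₂ t)
        - (1 / (T : ℝ)) * ∑ t ∈ Finset.Icc 1 T, checkFun α (z t)|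
      ≤ (1 / (T : ℝ)) * ∑ t ∈ Finset.Icc 1 T, (|n t| + B * |n₁ t| + B * |n₂ t|) := by
  rw [← mul_sub, ← Finset.sum_sub_distrib, abs_mul, abs_of_nonneg (by positivity)]
  gcongr
  refine (Finset.abs_sum_le_sum_abs _ _).trans (Finset.sum_le_sum fun t _ => ?_)
  refine (abs_checkFun_sub_le hα _ _).trans ?_
  calc |z t + n t - b * n₁ t - c * n₂ t - z t| = |n t - b * n₁ t - c * n₂ t| := by ring_nf
    _ ≤ |n t| + |b * n₁ t| + |c * n₂ t| :=
        (abs_sub _ _).trans (add_le_add_left (abs_sub _ _) _)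
    _ ≤ |n t| + B * |n₁ t| + B * |n₂ t| := by rw [abs_mul, abs_mul]; gcongr

/-- Proposition 1: if the measurement errors of the realized measures satisfy
`E[|·|^k] ≤ C·M(T)^{−k/2}` and `T^{2/(2k−1)}·M(T)^{−1/2} → 0`, then the supremum over the
compact parameter space `Θ` of the difference between the feasible objective `QR_{T,M}`
and the infeasible objective `QR_T` converges to zero in probability. -/
theorem feasible_objective_uniform_convergence_in_probability
    {Ω : Type*} [MeasurableSpace Ω] (P : Measure Ω) [IsProbabilityMeasure P]
    (α : ℝ) (hα : α ∈ Set.Ioo (0 : ℝ) 1)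
    (Θ : Set (ℝ × ℝ × ℝ)) (hΘ : IsCompact Θ)
    (y u v : ℕ → Ω → ℝ)
    (hy : ∀ t, Measurable (y t)) (hu : ∀ t, Measurable (u t)) (hv : ∀ t, Measurable (v t))
    (K : ℝ) (hK : 0 ≤ K)
    (hzint : ∀ t, 1 ≤ t → ∀ β ∈ Θ,
      Integrable (fun ω => (y t ω - β.1 - β.2.1 * u t ω - β.2.2 * v t ω) ^ 2) P)
    (hzmom : ∀ t, 1 ≤ t → ∀ β ∈ Θ,
      ∫ ω, (y t ω - β.1 - β.2.1 * u t ω - β.2.2 * v t ω) ^ 2 ∂P ≤ K ^ 2)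
    (k C : ℝ) (hk : 2 ≤ k) (hC : 0 ≤ C)
    (M : ℕ → ℝ) (hM : ∀ T, 0 < M T)
    (N Nc Nd : ℕ → ℕ → Ω → ℝ)
    (hNmeas : ∀ T t, Measurable (N T t))
    (hNcmeas : ∀ T t, Measurable (Nc T t))
    (hNdmeas : ∀ T t, Measurable (Nd T t))
    (hNint : ∀ T, 1 ≤ T → ∀ t, 1 ≤ t → t ≤ T → Integrable (fun ω => |N T t ω| ^ k) P)
    (hNcint : ∀ T, 1 ≤ T → ∀ t, 1 ≤ t → t ≤ T → Integrable (fun ω => |Nc T t ω| ^ k) P)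
    (hNdint : ∀ T, 1 ≤ T → ∀ t, 1 ≤ t → t ≤ T → Integrable (fun ω => |Nd T t ω| ^ k) P)
    (hNmom : ∀ T, 1 ≤ T → ∀ t, 1 ≤ t → t ≤ T →
      ∫ ω, |N T t ω| ^ k ∂P ≤ C * (M T) ^ (-(k / 2)))
    (hNcmom : ∀ T, 1 ≤ T → ∀ t, 1 ≤ t → t ≤ T →
      ∫ ω, |Nc T t ω| ^ k ∂P ≤ C * (M T) ^ (-(k / 2)))
    (hNdmom : ∀ T, 1 ≤ T → ∀ t, 1 ≤ t → t ≤ T →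
      ∫ ω, |Nd T t ω| ^ k ∂P ≤ C * (M T) ^ (-(k / 2)))
    (hrate : Tendsto (fun T : ℕ => (T : ℝ) ^ (2 / (2 * k - 1)) * (M T) ^ (-(1 : ℝ) / 2))
      atTop (nhds 0)) :
    ∀ ε > (0 : ℝ), Tendsto (fun T : ℕ =>
        P {ω | ε < ⨆ β ∈ Θ,
          |(1 / (T : ℝ)) * ∑ t ∈ Finset.Icc 1 T,
              checkFun α (y t ω - β.1 - β.2.1 * u t ω - β.2.2 * v t ω
                + N T t ω - β.2.1 * Nc T t ω - β.2.2 * Nd T t ω)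
            - (1 / (T : ℝ)) * ∑ t ∈ Finset.Icc 1 T,
              checkFun α (y t ω - β.1 - β.2.1 * u t ω - β.2.2 * v t ω)|})
      atTop (nhds 0) := by
  intro ε hε
  have hα' : α ∈ Set.Icc (0 : ℝ) 1 := ⟨hα.1.le, hα.2.le⟩
  have hk1 : 1 ≤ k := by linarith
  obtain ⟨B, hB0, hB⟩ : ∃ B : ℝ, 0 < B ∧ ∀ β ∈ Θ, ‖β‖ ≤ B := hΘ.isBounded.exists_pos_norm_le
  set s : ℕ → ℝ := fun T => (M T) ^ (-(1 : ℝ) / 2) with hs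
  have hspos : ∀ T, 0 < s T := fun T => Real.rpow_pos_of_pos (hM T) _
  have hsk : ∀ T, (M T) ^ (-(k / 2)) = s T ^ k := fun T => by
    rw [hs, ← Real.rpow_mul (hM T).le]
    ring_nf
  have hs0 : Tendsto s atTop (nhds 0) :=
    tendsto_zero_of_tendsto_rpow_mul (div_nonneg zero_le_two (by linarith))
      (fun T => (hspos T).le) hrate
  set D : ℝ := (1 + 2 * B) * (1 + C) with hD
  have hlim : Tendsto (fun T => ENNReal.ofReal (D * s T / ε)) atTop (nhds 0) := by
    simpa using ENNReal.tendsto_ofReal ((hs0.const_mul D).div_const ε)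
  refine tendsto_of_tendsto_of_tendsto_of_le_of_le' tendsto_const_nhds hlim
    (.of_forall fun _ => zero_le) ?_
  filter_upwards [eventually_ge_atTop 1] with T hT
  have hT0 : (0 : ℝ) < T := by exact_mod_cast hT
  let W : ℕ → Ω → ℝ := fun t ω => |N T t ω| + B * |Nc T t ω| + B * |Nd T t ω|
  have hWint : ∀ t ∈ Finset.Icc 1 T, Integrable (W t) P ∧ ∫ ω, W t ω ∂P ≤ D * s T := by
    intro t ht
    obtain ⟨h1, h2⟩ := Finset.mem_Icc.1 ht
    have i₀ := integrable_abs_of_integrable_rpow (hNmeas T t) hk1 (hNint T hT t h1 h2)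
    have i₁ := integrable_abs_of_integrable_rpow (hNcmeas T t) hk1 (hNcint T hT t h1 h2)
    have i₂ := integrable_abs_of_integrable_rpow (hNdmeas T t) hk1 (hNdint T hT t h1 h2)
    have b₀ := integral_abs_le_of_integral_rpow_le (hNmeas T t) hk1 (hspos T)
      (hNint T hT t h1 h2) (hsk T ▸ hNmom T hT t h1 h2)
    have b₁ := integral_abs_le_of_integral_rpow_le (hNcmeas T t) hk1 (hspos T)
      (hNcint T hT t h1 h2) (hsk T ▸ hNcmom T hT t h1 h2)
    have b₂ := integral_abs_le_of_integral_rpow_le (hNdmeas T t) hk1 (hspos T)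
      (hNdint T hT t h1 h2) (hsk T ▸ hNdmom T hT t h1 h2)
    have i₀₁ : Integrable (fun ω => |N T t ω| + B * |Nc T t ω|) P := i₀.add (i₁.const_mul B)
    refine ⟨i₀₁.add (i₂.const_mul B), ?_⟩
    calc ∫ ω, W t ω ∂P
        = ∫ ω, |N T t ω| ∂P + B * ∫ ω, |Nc T t ω| ∂P + B * ∫ ω, |Nd T t ω| ∂P := by
          rw [integral_add i₀₁ (i₂.const_mul B),
            integral_add i₀ (i₁.const_mul B), integral_const_mul, integral_const_mul]
      _ ≤ (1 + C) * s T + B * ((1 + C) * s T) + B * ((1 + C) * s T) := by gcongr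
      _ = D * s T := by rw [hD]; ring
  let A : Ω → ℝ := fun ω => (1 / (T : ℝ)) * ∑ t ∈ Finset.Icc 1 T, W t ω
  have hA0 : ∀ ω, 0 ≤ A ω := fun ω => by positivity
  have hAint : Integrable A P :=
    (integrable_finsetSum _ fun t ht => (hWint t ht).1).const_mul _
  have hAmean : ∫ ω, A ω ∂P ≤ D * s T := by
    calc ∫ ω, A ω ∂P = (1 / (T : ℝ)) * ∑ t ∈ Finset.Icc 1 T, ∫ ω, W t ω ∂P := by
          rw [integral_const_mul, integral_finsetSum _ fun t ht => (hWint t ht).1]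
      _ ≤ (1 / (T : ℝ)) * ∑ _t ∈ Finset.Icc 1 T, D * s T := by
          gcongr with t ht
          exact (hWint t ht).2
      _ = D * s T := by
          rw [Finset.sum_const, Nat.card_Icc, nsmul_eq_mul]
          field_simp
          simp
  have hmarkov : P.real {ω | ε ≤ A ω} ≤ D * s T / ε := by
    rw [le_div_iff₀' hε]
    exact (mul_meas_ge_le_integral_of_nonneg (.of_forall hA0) hAint ε).trans hAmean
  refine (measure_mono ?_).trans
    ((ENNReal.le_ofReal_iff_toReal_le (measure_ne_top _ _)
      (measureReal_nonneg.trans hmarkov)).2 hmarkov)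
  intro ω hω
  refine (Set.mem_ofPred_eq ▸ hω : ε < _).le.trans ?_
  refine Real.iSup_le (fun β => Real.iSup_le (fun hβ => ?_) (hA0 ω)) (hA0 ω)
  have hβ2 : ‖β.2‖ ≤ B := (norm_snd_le β).trans (hB β hβ)
  exact abs_checkFun_mean_sub_le hα' ((norm_fst_le β.2).trans hβ2) ((norm_snd_le β.2).trans hβ2) T
    (fun t => y t ω - β.1 - β.2.1 * u t ω - β.2.2 * v t ω) (N T · ω) (Nc T · ω) (Nd T · ω)
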